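/- Coercivity of the energy of the new gradient elasticity model with symmetric nonlocal force stress (core of Theorem 3.2): let Ω ⊆ ℝ³ be open and let μ, λ, L_c, α₁, α₂ ∈ ℝ satisfy μ > 0, 3λ + 2μ > 0, L_c > 0, α₁ > 0 and α₂ ≥ 0. Then there exists a constant c > 0 such that for every smooth compactly supported map u : ℝ³ → ℝ³ with support contained in Ω: ∫_Ω [ 2μ·‖sym ∇u‖² + λ·(tr ∇u)² + μ·L_c²·( 2α₁·‖dev(sym(Curl(sym ∇u)))‖² + 2α₂·‖skew(Curl(sym ∇u))‖² ) ] dx ≥ c · ∫_Ω ( ‖∇u‖² + ‖Curl(sym ∇u)‖² ) dx, where ‖·‖ is the Frobenius norm on 3×3 matrices. -/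

import Mathlib

open Matrix MeasureTheory

noncomputable section

abbrev V3 : Type := Fin 3 → ℝ
abbrev M3 : Type := Matrix (Fin 3) (Fin 3) ℝ

/-- Partial derivative `∂ⱼ f`. -/
def pd (j : Fin 3) (f : V3 → ℝ) (x : V3) : ℝ := fderiv ℝ f x (Pi.single j 1)

/-- Levi-Civita symbol `ε i j k`. -/
def lc (i j k : Fin 3) : ℝ :=
  ((j.val : ℝ) - i.val) * ((k.val : ℝ) - j.val) * ((k.val : ℝ) - i.val) / 2

/-- Gradient (Jacobian) of a vector field: `(∇u)ᵢⱼ = ∂ⱼ uᵢ`. -/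
def grad (u : V3 → V3) (x : V3) : M3 := Matrix.of fun i j => pd j (fun y => u y i) x

/-- curl of a vector field: `(curl u)ᵢ = ε i j k ∂ⱼ uₖ`. -/
def vcurl (u : V3 → V3) (x : V3) : V3 := fun i => ∑ j, ∑ k, lc i j k * pd j (fun y => u y k) x

/-- divergence of a vector field. -/
def vdiv (u : V3 → V3) (x : V3) : ℝ := ∑ i, pd i (fun y => u y i) x

/-- Row-wise Curl of a matrix field: `(Curl P)ᵢⱼ = ε j k l ∂ₖ P i l`. -/
def mCurl (P : V3 → M3) (x : V3) : M3 :=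
  Matrix.of fun i j => ∑ k, ∑ l, lc j k l * pd k (fun y => P y i l) x

/-- Row-wise divergence of a matrix field: `(Div P)ᵢ = ∂ⱼ P i j`. -/
def mDiv (P : V3 → M3) (x : V3) : V3 := fun i => ∑ j, pd j (fun y => P y i j) x

/-- Symmetric part of a matrix. -/
def symM (X : M3) : M3 := (1/2 : ℝ) • (X + Xᵀ)

/-- Skew-symmetric part of a matrix. -/
def skewM (X : M3) : M3 := (1/2 : ℝ) • (X - Xᵀ)

/-- Deviatoric (trace-free) part of a matrix. -/
def devM (X : M3) : M3 := X - (Matrix.trace X / 3) • (1 : M3)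

/-- The axial vector of a (skew-symmetric) matrix: `axl Ā = (Ā₃₂, Ā₁₃, Ā₂₁)`. -/
def axl (X : M3) : V3 := ![X 2 1, X 0 2, X 1 0]

/-- `(anti v)ᵢⱼ = -ε i j k vₖ`. -/
def antiV (v : V3) : M3 := Matrix.of fun i j => -∑ k, lc i j k * v k

/-- Cross product on `ℝ³`. -/
def cross3 (a b : V3) : V3 := fun i => ∑ j, ∑ k, lc i j k * a j * b k

/-- Euclidean inner product on `ℝ³`. -/
def dot3 (a b : V3) : ℝ := ∑ i, a i * b i

/-- Squared Frobenius norm of a matrix. -/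
def frob2 (X : M3) : ℝ := ∑ i, ∑ j, (X i j) ^ 2

theorem frob2_nonneg (X : M3) : 0 ≤ frob2 X :=
  Finset.sum_nonneg fun _ _ => Finset.sum_nonneg fun _ _ => sq_nonneg _

theorem two_mul_frob2_symM (X : M3) :
    2 * frob2 (symM X) = frob2 X + Matrix.trace (X * X) := by
  simp [frob2, symM, Matrix.trace, Matrix.mul_apply, Fin.sum_univ_three]
  ring

theorem sq_trace_le (X : M3) : Matrix.trace X ^ 2 ≤ 3 * frob2 (symM X) := by
  simp only [frob2, symM, Matrix.trace, Fin.sum_univ_three, Matrix.smul_apply, Matrix.add_apply,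
    Matrix.transpose_apply, Matrix.diag_apply, smul_eq_mul]
  nlinarith [sq_nonneg (X 0 0 - X 1 1), sq_nonneg (X 0 0 - X 2 2), sq_nonneg (X 1 1 - X 2 2),
    sq_nonneg (X 0 1 + X 1 0), sq_nonneg (X 0 2 + X 2 0), sq_nonneg (X 1 2 + X 2 1)]

theorem trace_symM (X : M3) : Matrix.trace (symM X) = Matrix.trace X := by
  simp only [symM, Matrix.trace_smul, Matrix.trace_add, Matrix.trace_transpose, smul_eq_mul]
  ring

/-- The local part of the energy controls the square of the symmetric gradient. -/
theorem mul_frob2_symM_le {μ lam b : ℝ} (h₁ : b ≤ 2 * μ) (h₂ : b ≤ 2 * μ + 3 * lam) (X : M3) :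
    b * frob2 (symM X) ≤ 2 * μ * frob2 (symM X) + lam * Matrix.trace X ^ 2 := by
  have hs := frob2_nonneg (symM X)
  have ht := sq_trace_le X
  rcases le_total 0 lam with h | h
  · nlinarith [mul_nonneg h (sq_nonneg (Matrix.trace X)), mul_nonneg (sub_nonneg.2 h₁) hs]
  · nlinarith [mul_le_mul_of_nonpos_left ht h, mul_nonneg (sub_nonneg.2 h₂) hs]

theorem pd_contDiff {f : V3 → ℝ} (hf : ContDiff ℝ (⊤ : ℕ∞) f) (j : Fin 3) :
    ContDiff ℝ (⊤ : ℕ∞) (pd j f) :=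
  (hf.fderiv_right (m := (⊤ : ℕ∞)) (by simp)).clm_apply contDiff_const

theorem pd_hasCompactSupport {f : V3 → ℝ} (hf : HasCompactSupport f) (j : Fin 3) :
    HasCompactSupport (pd j f) :=
  hf.fderiv_apply ℝ _

theorem pd_comm {f : V3 → ℝ} (hf : ContDiff ℝ (⊤ : ℕ∞) f) (i j : Fin 3) (x : V3) :
    pd i (pd j f) x = pd j (pd i f) x := by
  have hd : DifferentiableAt ℝ (fderiv ℝ f) x :=
    (hf.fderiv_right (m := (⊤ : ℕ∞)) (by simp)).differentiable (by simp) x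
  have key (k l : Fin 3) : pd k (pd l f) x =
      fderiv ℝ (fderiv ℝ f) x (Pi.single k 1) (Pi.single l 1) := by
    unfold pd
    rw [fderiv_clm_apply hd (differentiableAt_const _)]
    simp
  rw [key, key]
  exact (hf.contDiffAt.isSymmSndFDerivAt (by
    simpa using WithTop.coe_le_coe.2 (le_top : (2 : ℕ∞) ≤ ⊤))).eq _ _

theorem integral_mul_pd {f g : V3 → ℝ} (hf : ContDiff ℝ (⊤ : ℕ∞) f)
    (hg : ContDiff ℝ (⊤ : ℕ∞) g) (hgc : HasCompactSupport g) (j : Fin 3) :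
    ∫ x, f x * pd j g x = -∫ x, pd j f x * g x := by
  have hi {a b : V3 → ℝ} (ha : ContDiff ℝ (⊤ : ℕ∞) a) (hb : ContDiff ℝ (⊤ : ℕ∞) b)
      (hbc : HasCompactSupport b) : Integrable fun x => a x * b x :=
    (ha.continuous.mul hb.continuous).integrable_of_hasCompactSupport hbc.mul_left
  exact integral_mul_fderiv_eq_neg_fderiv_mul_of_integrable
    (hi (pd_contDiff hf j) hg hgc) (hi hf (pd_contDiff hg j) (pd_hasCompactSupport hgc j))
    (hi hf hg hgc) (fun x _ => hf.differentiable (by simp) x)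
    (fun x _ => hg.differentiable (by simp) x)

theorem integral_pd_mul_pd_swap {f g : V3 → ℝ} (hf : ContDiff ℝ (⊤ : ℕ∞) f)
    (hg : ContDiff ℝ (⊤ : ℕ∞) g) (hgc : HasCompactSupport g) (i j : Fin 3) :
    ∫ x, pd i f x * pd j g x = ∫ x, pd j f x * pd i g x := by
  rw [integral_mul_pd (pd_contDiff hf i) hg hgc, integral_mul_pd (pd_contDiff hf j) hg hgc]
  simp only [pd_comm hf i j]

theorem coord_contDiff {v : V3 → V3} (hv : ContDiff ℝ (⊤ : ℕ∞) v) (i : Fin 3) :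
    ContDiff ℝ (⊤ : ℕ∞) fun x => v x i :=
  contDiff_pi.1 hv i

theorem coord_hasCompactSupport {v : V3 → V3} (hv : HasCompactSupport v) (i : Fin 3) :
    HasCompactSupport fun x => v x i :=
  hv.comp_left (g := fun y : V3 => y i) rfl

/-- Integrating by parts twice, `∫ tr((∇v)²) = ∫ (div v)²`. -/
theorem integral_trace_grad_mul_grad_nonneg {v : V3 → V3} (hv : ContDiff ℝ (⊤ : ℕ∞) v)
    (hvc : HasCompactSupport v) : 0 ≤ ∫ x, Matrix.trace (grad v x * grad v x) := by
  have hi (i j k l : Fin 3) :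
      Integrable fun x => pd i (fun y => v y j) x * pd k (fun y => v y l) x :=
    ((pd_contDiff (coord_contDiff hv j) i).continuous.mul
      (pd_contDiff (coord_contDiff hv l) k).continuous).integrable_of_hasCompactSupport
      (pd_hasCompactSupport (coord_hasCompactSupport hvc l) k).mul_left
  have h : ∫ x, Matrix.trace (grad v x * grad v x) = ∫ x, vdiv v x ^ 2 := by
    simp only [Matrix.trace, Matrix.diag_apply, Matrix.mul_apply, grad, Matrix.of_apply, vdiv, sq,
      Finset.sum_mul_sum]
    rw [integral_finsetSum _ fun i _ => integrable_finsetSum _ fun j _ => hi _ _ _ _,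
      integral_finsetSum _ fun i _ => integrable_finsetSum _ fun j _ => hi _ _ _ _]
    refine Finset.sum_congr rfl fun i _ => ?_
    rw [integral_finsetSum _ fun j _ => hi _ _ _ _, integral_finsetSum _ fun j _ => hi _ _ _ _]
    exact Finset.sum_congr rfl fun j _ => integral_pd_mul_pd_swap (coord_contDiff hv i)
      (coord_contDiff hv j) (coord_hasCompactSupport hvc j) j i
  rw [h]
  exact integral_nonneg fun x => sq_nonneg _

theorem grad_continuous {v : V3 → V3} (hv : ContDiff ℝ (⊤ : ℕ∞) v) : Continuous (grad v) :=
  continuous_matrix fun i j => (pd_contDiff (coord_contDiff hv i) j).continuous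

theorem pd_eq_zero_of_notMem_tsupport {f : V3 → ℝ} {x : V3} (hx : x ∉ tsupport f) (j : Fin 3) :
    pd j f x = 0 := by
  rw [pd, fderiv_of_notMem_tsupport _ hx, _root_.zero_apply]

theorem grad_eq_zero_of_notMem_tsupport {v : V3 → V3} {x : V3} (hx : x ∉ tsupport v) :
    grad v x = 0 := by
  ext i j
  exact pd_eq_zero_of_notMem_tsupport
    (fun h => hx (tsupport_comp_subset (g := fun y : V3 => y i) rfl v h)) j

theorem vcurl_contDiff {v : V3 → V3} (hv : ContDiff ℝ (⊤ : ℕ∞) v) :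
    ContDiff ℝ (⊤ : ℕ∞) (vcurl v) :=
  contDiff_pi.2 fun _ => ContDiff.sum fun j _ => ContDiff.sum fun k _ =>
    contDiff_const.mul (pd_contDiff (coord_contDiff hv k) j)

theorem vcurl_eq_zero_of_notMem_tsupport {v : V3 → V3} {x : V3} (hx : x ∉ tsupport v) :
    vcurl v x = 0 := by
  have h (j k : Fin 3) : pd j (fun y => v y k) x = 0 :=
    congrFun (congrFun (grad_eq_zero_of_notMem_tsupport hx) k) j
  funext i
  simp [vcurl, h]

theorem tsupport_vcurl_subset (v : V3 → V3) : tsupport (vcurl v) ⊆ tsupport v :=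
  closure_minimal (fun _ hx => by_contra fun h => hx (vcurl_eq_zero_of_notMem_tsupport h))
    (isClosed_tsupport v)

theorem pd_add {f g : V3 → ℝ} (hf : ContDiff ℝ (⊤ : ℕ∞) f) (hg : ContDiff ℝ (⊤ : ℕ∞) g)
    (j : Fin 3) (x : V3) : pd j (fun y => f y + g y) x = pd j f x + pd j g x := by
  simp [pd, fderiv_fun_add (hf.differentiable (by simp) x) (hg.differentiable (by simp) x)]

theorem pd_const_mul {f : V3 → ℝ} (hf : ContDiff ℝ (⊤ : ℕ∞) f) (a : ℝ) (j : Fin 3) (x : V3) :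
    pd j (fun y => a * f y) x = a * pd j f x := by
  simp [pd, fderiv_const_mul (hf.differentiable (by simp) x)]

theorem pd_sum {ι : Type*} (s : Finset ι) {f : ι → V3 → ℝ}
    (hf : ∀ i, ContDiff ℝ (⊤ : ℕ∞) (f i)) (j : Fin 3) (x : V3) :
    pd j (fun y => ∑ i ∈ s, f i y) x = ∑ i ∈ s, pd j (f i) x := by
  simp [pd, fderiv_fun_sum fun i _ => (hf i).differentiable (by simp) x]

theorem pd_vcurl {u : V3 → V3} (hu : ContDiff ℝ (⊤ : ℕ∞) u) (i j : Fin 3) (x : V3) :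
    pd i (fun y => vcurl u y j) x =
      ∑ k, ∑ l, lc j k l * pd i (pd k fun y => u y l) x := by
  have hp (k l : Fin 3) := pd_contDiff (coord_contDiff hu l) k
  simp only [vcurl]
  rw [pd_sum _ fun k => ContDiff.sum fun l _ => contDiff_const.mul (hp k l)]
  refine Finset.sum_congr rfl fun k _ => ?_
  rw [pd_sum _ fun l => contDiff_const.mul (hp k l)]
  exact Finset.sum_congr rfl fun l _ => pd_const_mul (hp k l) _ _ _

/-- `Curl (sym ∇u) = ½ (∇ curl u)ᵀ`, since `Curl ∇u = 0`. -/
theorem mCurl_symM_grad {u : V3 → V3} (hu : ContDiff ℝ (⊤ : ℕ∞) u) (x : V3) :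
    mCurl (fun y => symM (grad u y)) x = (1 / 2 : ℝ) • (grad (vcurl u) x)ᵀ := by
  have hp (k l : Fin 3) := pd_contDiff (coord_contDiff hu l) k
  have hs (i k l : Fin 3) : pd k (fun y => symM (grad u y) i l) x =
      1 / 2 * (pd k (pd l fun y => u y i) x + pd i (pd k fun y => u y l) x) := by
    rw [pd_comm (coord_contDiff hu l) i, ← pd_add (hp l i) (hp i l),
      ← pd_const_mul ((hp l i).add (hp i l))]
    rfl
  ext i j
  have h (k l : Fin 3) := pd_comm (coord_contDiff hu i) k l x
  change ∑ k, ∑ l, lc j k l * pd k (fun y => symM (grad u y) i l) x =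
    1 / 2 * pd i (fun y => vcurl u y j) x
  simp only [hs, pd_vcurl hu, Fin.sum_univ_three]
  rw [h 1 0, h 2 0, h 2 1]
  fin_cases j <;> simp [lc] <;> ring

theorem trace_grad_vcurl {u : V3 → V3} (hu : ContDiff ℝ (⊤ : ℕ∞) u) (x : V3) :
    Matrix.trace (grad (vcurl u) x) = 0 := by
  have h (i k l : Fin 3) := pd_comm (coord_contDiff hu i) k l x
  simp only [Matrix.trace, Matrix.diag_apply, grad, Matrix.of_apply, pd_vcurl hu,
    Fin.sum_univ_three]
  rw [h 0 2 1, h 1 2 0, h 2 1 0]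
  simp [lc]
  ring

/-- Coercivity of the energy of the new gradient elasticity model with
symmetric nonlocal force stress. -/
theorem energy_coercivity (Ω : Set V3) (hΩ : IsOpen Ω) (μ lam Lc α₁ α₂ : ℝ)
    (hμ : 0 < μ) (hlam : 0 < 3 * lam + 2 * μ) (hLc : 0 < Lc)
    (hα₁ : 0 < α₁) (hα₂ : 0 ≤ α₂) :
    ∃ c : ℝ, 0 < c ∧ ∀ u : V3 → V3,
      ContDiff ℝ (⊤ : ℕ∞) u → HasCompactSupport u → tsupport u ⊆ Ω →
      (∫ x in Ω,
          (2 * μ * frob2 (symM (grad u x)) + lam * (Matrix.trace (grad u x)) ^ 2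
            + μ * Lc ^ 2 *
              (2 * α₁ * frob2 (devM (symM (mCurl (fun y => symM (grad u y)) x)))
                + 2 * α₂ * frob2 (skewM (mCurl (fun y => symM (grad u y)) x)))))
        ≥ c * ∫ x in Ω,
            (frob2 (grad u x) + frob2 (mCurl (fun y => symM (grad u y)) x)) := by
  obtain ⟨c, hc, h₁, h₂, h₃⟩ : ∃ c : ℝ, 0 < c ∧ 2 * c ≤ 2 * μ ∧ 2 * c ≤ 2 * μ + 3 * lam ∧
      c ≤ μ * Lc ^ 2 * α₁ := by
    have : 0 < μ + 3 / 2 * lam := by linarith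
    have : 0 < μ * Lc ^ 2 * α₁ := by positivity
    refine ⟨min μ (min (μ + 3 / 2 * lam) (μ * Lc ^ 2 * α₁)), by positivity, ?_, ?_, ?_⟩
    · linarith [min_le_left μ (min (μ + 3 / 2 * lam) (μ * Lc ^ 2 * α₁))]
    · linarith [(min_le_right μ (min (μ + 3 / 2 * lam) (μ * Lc ^ 2 * α₁))).trans (min_le_left _ _)]
    · exact (min_le_right _ _).trans (min_le_right _ _)
  refine ⟨c, hc, fun u hu huc huΩ => ?_⟩
  have hw := vcurl_contDiff hu
  have hwc : HasCompactSupport (vcurl u) :=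
    huc.of_isClosed_subset (isClosed_tsupport _) (tsupport_vcurl_subset u)
  have hA := grad_continuous hu
  have hW := grad_continuous hw
  have hA0 : ∀ x ∉ tsupport u, grad u x = 0 := fun x hx => grad_eq_zero_of_notMem_tsupport hx
  have hW0 : ∀ x ∉ tsupport u, grad (vcurl u) x = 0 := fun x hx =>
    grad_eq_zero_of_notMem_tsupport fun h => hx (tsupport_vcurl_subset u h)
  have hwtr := trace_grad_vcurl hu
  have hTA := integral_trace_grad_mul_grad_nonneg hu huc
  have hTW := integral_trace_grad_mul_grad_nonneg hw hwc
  simp only [mCurl_symM_grad hu]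
  generalize grad u = A at *
  generalize grad (vcurl u) = W at *
  have hint {f : V3 → ℝ} (hf : Continuous f) (h0 : ∀ x ∉ tsupport u, f x = 0) : Integrable f :=
    hf.integrable_of_hasCompactSupport (HasCompactSupport.intro huc h0)
  rw [setIntegral_eq_integral_of_forall_compl_eq_zero,
    setIntegral_eq_integral_of_forall_compl_eq_zero]
  rotate_left
  · intro x hx
    simp [hA0 x fun h => hx (huΩ h), hW0 x fun h => hx (huΩ h), frob2]
  · intro x hx
    simp [hA0 x fun h => hx (huΩ h), hW0 x fun h => hx (huΩ h), frob2, symM, skewM, devM]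
  have hFi : Integrable fun x => frob2 (A x) + frob2 ((1 / 2 : ℝ) • (W x)ᵀ) :=
    hint (by unfold frob2; fun_prop) fun x hx => by simp [hA0 x hx, hW0 x hx, frob2]
  have hTAi : Integrable fun x => Matrix.trace (A x * A x) :=
    hint (by fun_prop) fun x hx => by simp [hA0 x hx]
  have hTWi : Integrable fun x => Matrix.trace (W x * W x) :=
    hint (by fun_prop) fun x hx => by simp [hW0 x hx]
  have hsum : Integrable fun x => c * (frob2 (A x) + frob2 ((1 / 2 : ℝ) • (W x)ᵀ))
      + c * Matrix.trace (A x * A x) := (hFi.const_mul c).add (hTAi.const_mul c)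
  calc c * ∫ x, (frob2 (A x) + frob2 ((1 / 2 : ℝ) • (W x)ᵀ))
      ≤ c * (∫ x, (frob2 (A x) + frob2 ((1 / 2 : ℝ) • (W x)ᵀ)))
          + c * (∫ x, Matrix.trace (A x * A x)) + c / 4 * ∫ x, Matrix.trace (W x * W x) := by
        have := mul_nonneg hc.le hTA
        have := mul_nonneg (by positivity : 0 ≤ c / 4) hTW
        linarith
    _ = ∫ x, (c * (frob2 (A x) + frob2 ((1 / 2 : ℝ) • (W x)ᵀ))
          + c * Matrix.trace (A x * A x) + c / 4 * Matrix.trace (W x * W x)) := by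
        rw [integral_add hsum (hTWi.const_mul _),
          integral_add (hFi.const_mul c) (hTAi.const_mul c)]
        simp only [integral_const_mul]
    _ ≤ _ := by
        refine integral_mono (hsum.add (hTWi.const_mul _))
          (hint (by unfold frob2 devM symM skewM; fun_prop) fun x hx => by
            simp [hA0 x hx, hW0 x hx, frob2, symM, skewM, devM]) fun x => ?_
        have hK : Matrix.trace ((1 / 2 : ℝ) • (W x)ᵀ) = 0 := by simp [hwtr]
        have hKK : Matrix.trace (((1 / 2 : ℝ) • (W x)ᵀ) * ((1 / 2 : ℝ) • (W x)ᵀ)) =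
            1 / 4 * Matrix.trace (W x * W x) := by
          rw [smul_mul_smul_comm, ← Matrix.transpose_mul, Matrix.trace_smul,
            Matrix.trace_transpose, smul_eq_mul]
          norm_num
        generalize (1 / 2 : ℝ) • (W x)ᵀ = K at hK hKK ⊢
        have hdev : devM (symM K) = symM K := by simp [devM, trace_symM, hK]
        have hskew : 0 ≤ μ * Lc ^ 2 * (2 * α₂ * frob2 (skewM K)) := by
          have := frob2_nonneg (skewM K)
          positivity
        have hlocal := mul_frob2_symM_le h₁ h₂ (A x)
        have hcurl := mul_le_mul_of_nonneg_right h₃ (frob2_nonneg (symM K))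
        have hsA := congrArg (c * ·) (two_mul_frob2_symM (A x))
        have hsK := congrArg (c * ·) (two_mul_frob2_symM K)
        simp only [hdev, hKK] at hsA hsK ⊢
        linarith
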